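/- Let L > 0, T > 0, and let ψ : ℝ × ℝ → ℝ be continuous on [0, L] × [0, T] such that at every point of (0, L) × (0, T] the partial derivatives ∂ₜψ and ∂ₓ²ψ exist and ∂ₜψ = ∂ₓ²ψ. Assume ψ(x, t) > 0 for all (x, t) ∈ (0, L) × (0, T], and let t₀ ∈ (0, T] be such that ψ(0, t₀) = 0 and the one-sided space derivative ∂ₓψ(0, t₀) (the derivative from the right of x ↦ ψ(x, t₀) at x = 0) exists. Then ∂ₓψ(0, t₀) > 0. -/

import Mathlib

open Real Set MeasureTheory intervalIntegral

/-- Partial derivative in the first (space) variable. -/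
noncomputable def pdx (f : ℝ × ℝ → ℝ) (p : ℝ × ℝ) : ℝ :=
  deriv (fun x => f (x, p.2)) p.1

/-- Partial derivative in the second (time) variable. -/
noncomputable def pdt (f : ℝ × ℝ → ℝ) (p : ℝ × ℝ) : ℝ :=
  deriv (fun t => f (p.1, t)) p.2

/-- Second partial derivative in the first (space) variable. -/
noncomputable def pdxx (f : ℝ × ℝ → ℝ) (p : ℝ × ℝ) : ℝ :=
  deriv (fun x => pdx f (x, p.2)) p.1

open Filter Topology

lemma aux_second (g : ℝ → ℝ) (x : ℝ) (hm : IsLocalMin g x) (hc : ContinuousAt g x) :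
    0 ≤ deriv (deriv g) x := by
  by_contra! hneg
  have h1 : IsLocalMax g x :=
    isLocalMax_of_deriv_deriv_neg hneg hm.deriv_eq_zero hc
  have h2 : g =ᶠ[𝓝 x] fun _ => g x := by
    filter_upwards [h1, hm] with y a b using le_antisymm a b
  have h3 := h2.deriv.deriv_eq
  simp at h3
  linarith

lemma aux_left (h : ℝ → ℝ) (h' a t : ℝ) (hat : a < t) (hd : HasDerivAt h h' t)
    (hm : ∀ s ∈ Set.Icc a t, h t ≤ h s) : h' ≤ 0 := by
  have h1 := (hasDerivWithinAt_iff_tendsto_slope' (s := Set.Iio t) (by simp)).1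
    (hd.hasDerivWithinAt (s := Set.Iio t))
  refine le_of_tendsto h1 ?_
  filter_upwards [Ioo_mem_nhdsLT hat] with s hs
  rw [slope_def_field]
  exact div_nonpos_of_nonneg_of_nonpos (by linarith [hm s ⟨hs.1.le, hs.2.le⟩])
    (by linarith [hs.2])

/-- Hopf boundary point lemma for the heat equation on an
interval: a positive solution vanishing at the boundary point `x = 0` at time
`t₀` has strictly positive one-sided space derivative there. -/
theorem stmt_9 (L T : ℝ) (hL : 0 < L) (hT : 0 < T)
    (ψ : ℝ × ℝ → ℝ)
    (hcont : ContinuousOn ψ (Set.Icc 0 L ×ˢ Set.Icc 0 T))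
    (hψt : ∀ p ∈ Set.Ioo 0 L ×ˢ Set.Ioc 0 T, DifferentiableAt ℝ (fun t => ψ (p.1, t)) p.2)
    (hψx : ∀ p ∈ Set.Ioo 0 L ×ˢ Set.Ioc 0 T, DifferentiableAt ℝ (fun x => ψ (x, p.2)) p.1)
    (hψxx : ∀ p ∈ Set.Ioo 0 L ×ˢ Set.Ioc 0 T, DifferentiableAt ℝ (fun x => pdx ψ (x, p.2)) p.1)
    (hheat : ∀ p ∈ Set.Ioo 0 L ×ˢ Set.Ioc 0 T, pdt ψ p = pdxx ψ p)
    (hpos : ∀ p ∈ Set.Ioo 0 L ×ˢ Set.Ioc 0 T, 0 < ψ p)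
    (t₀ : ℝ) (ht₀ : t₀ ∈ Set.Ioc 0 T) (hzero : ψ (0, t₀) = 0)
    (d : ℝ) (hd : HasDerivWithinAt (fun x => ψ (x, t₀)) d (Set.Ici 0) 0) :
    0 < d := by
  obtain ⟨ht0, htT⟩ := ht₀
  -- the width of the small rectangle
  obtain ⟨δ, hδ0, hδL, hδt⟩ : ∃ δ : ℝ, 0 < δ ∧ δ < L ∧ δ + δ ^ 2 ≤ t₀ / 2 := by
    refine ⟨min (L / 2) (min 1 (t₀ / 4)), by positivity, ?_, ?_⟩
    · have := min_le_left (L / 2) (min 1 (t₀ / 4))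
      linarith
    · have h0 : 0 < min (L / 2) (min 1 (t₀ / 4)) := by positivity
      have h1 : min (L / 2) (min 1 (t₀ / 4)) ≤ 1 := (min_le_right _ _).trans (min_le_left _ _)
      have h2 : min (L / 2) (min 1 (t₀ / 4)) ≤ t₀ / 4 :=
        (min_le_right _ _).trans (min_le_right _ _)
      nlinarith
  have hsub : Set.Icc 0 δ ×ˢ Set.Icc (t₀ / 2) t₀ ⊆ Set.Icc 0 L ×ˢ Set.Icc 0 T := by
    rintro ⟨x, t⟩ ⟨⟨h1, h2⟩, h3, h4⟩
    simp only at h1 h2 h3 h4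
    exact ⟨⟨h1, by linarith⟩, by simp only; linarith, by simp only; linarith⟩
  -- nonnegativity on the closed rectangle
  have hnn0 : ∀ t ∈ Set.Icc (t₀ / 2) t₀, 0 ≤ ψ (0, t) := by
    intro t ht
    have hc : ContinuousWithinAt (fun x => ψ (x, t)) (Set.Icc 0 L) 0 := by
      have : ContinuousOn (fun x => ψ (x, t)) (Set.Icc 0 L) := by
        refine hcont.comp (by fun_prop) ?_
        intro x hx
        exact ⟨hx, by simp only; linarith [ht.1], by simp only; linarith [ht.2]⟩
      exact this 0 ⟨le_rfl, hL.le⟩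
    have hc2 : Tendsto (fun x => ψ (x, t)) (𝓝[>] 0) (𝓝 (ψ (0, t))) := by
      have h1 := hc.mono (Set.Ioo_subset_Icc_self)
      rw [ContinuousWithinAt, nhdsWithin_Ioo_eq_nhdsGT hL] at h1
      exact h1
    refine ge_of_tendsto hc2 ?_
    filter_upwards [Ioo_mem_nhdsGT hL] with x hx
    exact (hpos (x, t) ⟨hx, by simp only; linarith [ht.1], by simp only; linarith [ht.2]⟩).le
  have hnn : ∀ x ∈ Set.Icc 0 δ, ∀ t ∈ Set.Icc (t₀ / 2) t₀, 0 ≤ ψ (x, t) := by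
    intro x hx t ht
    rcases hx.1.eq_or_lt with h | h
    · rw [← h]; exact hnn0 t ht
    · exact (hpos (x, t) ⟨⟨h, by simp only; linarith [hx.2]⟩, by simp only; linarith [ht.1],
        by simp only; linarith [ht.2]⟩).le
  -- a positive lower bound on the right side
  obtain ⟨m, hm0, hm⟩ : ∃ m : ℝ, 0 < m ∧ ∀ t ∈ Set.Icc (t₀ / 2) t₀, m ≤ ψ (δ, t) := by
    have hc : ContinuousOn (fun t => ψ (δ, t)) (Set.Icc (t₀ / 2) t₀) := by
      refine hcont.comp (by fun_prop) ?_
      intro t ht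
      exact hsub ⟨⟨hδ0.le, le_rfl⟩, ht⟩
    obtain ⟨s, hs, hmin⟩ := isCompact_Icc.exists_isMinOn
      (Set.nonempty_Icc.2 (by linarith : t₀ / 2 ≤ t₀)) hc
    exact ⟨ψ (δ, s), hpos (δ, s) ⟨⟨hδ0, hδL⟩, by simp only; linarith [hs.1],
      by simp only; linarith [hs.2]⟩, fun t ht => hmin ht⟩
  obtain ⟨ε, hε0, hε⟩ : ∃ ε : ℝ, 0 < ε ∧ ε * (δ + δ ^ 2) = m :=
    ⟨m / (δ + δ ^ 2), by positivity, by field_simp⟩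
  -- comparison
  have hcomp : ∀ q ∈ Set.Icc 0 δ ×ˢ Set.Icc (t₀ / 2) t₀,
      0 ≤ ψ q - ε * (q.1 + q.1 ^ 2 - (t₀ - q.2)) := by
    have hc : ContinuousOn (fun q : ℝ × ℝ => ψ q - ε * (q.1 + q.1 ^ 2 - (t₀ - q.2)))
        (Set.Icc 0 δ ×ˢ Set.Icc (t₀ / 2) t₀) :=
      (hcont.mono hsub).sub (by fun_prop)
    obtain ⟨⟨x, t⟩, ⟨⟨hx0, hxδ⟩, ht1, ht2⟩, hmin⟩ :=
      (isCompact_Icc.prod isCompact_Icc).exists_isMinOn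
        ⟨(0, t₀), ⟨le_rfl, hδ0.le⟩, by simp only; linarith, le_rfl⟩ hc
    rw [isMinOn_iff] at hmin
    simp only at hx0 hxδ ht1 ht2 hmin
    intro q hq
    refine le_trans ?_ (hmin q hq)
    by_contra! hneg
    have hψ0 := hnn x ⟨hx0, hxδ⟩ t ⟨ht1, ht2⟩
    have hxpos : 0 < x := by
      refine lt_of_le_of_ne hx0 fun h => ?_
      rw [← h] at hneg hψ0
      nlinarith
    have hxlt : x < δ := by
      refine lt_of_le_of_ne hxδ fun h => ?_
      have := hm t ⟨ht1, ht2⟩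
      rw [h] at hneg
      nlinarith
    have htlt : t₀ / 2 < t := by
      refine lt_of_le_of_ne ht1 fun h => ?_
      rw [← h] at hneg hψ0
      have : x + x ^ 2 ≤ t₀ / 2 := by nlinarith
      nlinarith
    have hmem : ∀ y ∈ Set.Ioo 0 δ, (y, t) ∈ Set.Ioo 0 L ×ˢ Set.Ioc 0 T := fun y hy =>
      ⟨⟨hy.1, by simp only; linarith [hy.2]⟩, by simp only; linarith, by simp only; linarith⟩
    have hxt := hmem x ⟨hxpos, hxlt⟩
    -- time derivative
    have htd : HasDerivAt (fun s => ψ (x, s) - ε * (x + x ^ 2 - (t₀ - s)))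
        (pdt ψ (x, t) - ε * 1) t := by
      refine (hψt _ hxt).hasDerivAt.sub ?_
      refine HasDerivAt.const_mul ε ?_
      have h1 := (((hasDerivAt_id t).const_sub t₀).const_sub (x + x ^ 2))
      simpa using h1
    have ht' : pdt ψ (x, t) - ε * 1 ≤ 0 :=
      aux_left _ _ _ _ htlt htd fun s hs =>
        hmin (x, s) ⟨⟨hx0, hxδ⟩, hs.1, hs.2.trans ht2⟩
    -- space derivative
    have hxd : ∀ y ∈ Set.Ioo 0 δ,
        HasDerivAt (fun y => ψ (y, t) - ε * (y + y ^ 2 - (t₀ - t)))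
        (pdx ψ (y, t) - ε * (1 + 2 * y)) y := by
      intro y hy
      refine (hψx _ (hmem y hy)).hasDerivAt.sub ?_
      refine HasDerivAt.const_mul ε ?_
      have h1 := ((hasDerivAt_id y).add (hasDerivAt_pow 2 y)).sub_const (t₀ - t)
      simpa using h1
    have hev : deriv (fun y => ψ (y, t) - ε * (y + y ^ 2 - (t₀ - t))) =ᶠ[𝓝 x]
        fun y => pdx ψ (y, t) - ε * (1 + 2 * y) := by
      filter_upwards [Ioo_mem_nhds hxpos hxlt] with y hy using (hxd y hy).deriv
    have hxx : HasDerivAt (fun y => pdx ψ (y, t) - ε * (1 + 2 * y))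
        (pdxx ψ (x, t) - ε * 2) x := by
      refine (hψxx _ hxt).hasDerivAt.sub ?_
      refine HasDerivAt.const_mul ε ?_
      have h1 := ((hasDerivAt_id x).const_mul 2).const_add 1
      simpa using h1
    have hloc : IsLocalMin (fun y => ψ (y, t) - ε * (y + y ^ 2 - (t₀ - t))) x := by
      filter_upwards [Ioo_mem_nhds hxpos hxlt] with y hy
      exact hmin (y, t) ⟨⟨hy.1.le, hy.2.le⟩, ht1, ht2⟩
    have h2 := aux_second _ x hloc (hxd x ⟨hxpos, hxlt⟩).continuousAt
    rw [hev.deriv_eq, hxx.deriv] at h2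
    have h3 := hheat _ hxt
    linarith
  -- conclusion
  have hs := (hasDerivWithinAt_iff_tendsto_slope' (s := Set.Ioi 0) (by simp)).1
    (hd.mono Set.Ioi_subset_Ici_self)
  refine lt_of_lt_of_le hε0 (ge_of_tendsto hs ?_)
  filter_upwards [Ioo_mem_nhdsGT hδ0] with x hx
  have h1 := hcomp (x, t₀) ⟨⟨hx.1.le, hx.2.le⟩, by simp only; linarith, le_rfl⟩
  simp only at h1
  rw [slope_def_field, hzero, sub_zero, sub_zero, le_div_iff₀ hx.1]
  nlinarith [mul_pos hε0 (pow_pos hx.1 2)]
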